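/- Let n₁,n₂ ≥ 2, 1 ≤ s₁ ≤ n₁, 1 ≤ s₂ ≤ n₂, and suppose m ≥ 2(n₁+n₂)−4 if s₁ = n₁ and s₂ = n₂, and m ≥ 2(s₁+s₂)−2 otherwise. Then for Lebesgue-almost every pair (Y,Z) ∈ M(m,n₁) × M(m,n₂), the linear map M_{Y,Z} : M(n₁,n₂) → ℂ^m defined by M_{Y,Z}(X) = (tr(Z₁ᵗY₁X),…,tr(Z_mᵗY_mX)), where Y_i ∈ ℂ^{n₁} and Z_i ∈ ℂ^{n₂} denote the i-th rows of Y and Z regarded as row vectors (so that Z_iᵗY_i is an n₂×n₁ rank-one matrix), is stably (s₁,s₂)-injective. -/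

import Mathlib

noncomputable section

/-- A vector in `ℂⁿ` is `s`-sparse if it has at most `s` nonzero entries. -/
def Sparse {n : ℕ} (s : ℕ) (u : Fin n → ℂ) : Prop := {i | u i ≠ 0}.ncard ≤ s

/-- `M¹_{s₁,s₂}(n₁,n₂)`: matrices of the form `u vᵗ` with `u` `s₁`-sparse and `v` `s₂`-sparse. -/
def M1 (n₁ n₂ s₁ s₂ : ℕ) : Set (Matrix (Fin n₁) (Fin n₂) ℂ) :=
  {X | ∃ u : Fin n₁ → ℂ, ∃ v : Fin n₂ → ℂ,
    Sparse s₁ u ∧ Sparse s₂ v ∧ X = Matrix.vecMulVec u v}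

/-- `Δ(S) = {X - Y : X, Y ∈ S}`. -/
def diffSet {n₁ n₂ : ℕ} (S : Set (Matrix (Fin n₁) (Fin n₂) ℂ)) :
    Set (Matrix (Fin n₁) (Fin n₂) ℂ) :=
  {Z | ∃ X ∈ S, ∃ Y ∈ S, Z = X - Y}

/-- Frobenius norm of a complex matrix. -/
def frob {a b : ℕ} (X : Matrix (Fin a) (Fin b) ℂ) : ℝ :=
  Real.sqrt (∑ i, ∑ j, ‖X i j‖ ^ 2)

/-- Euclidean norm of a vector in `ℂ^m`. -/
def l2 {m : ℕ} (v : Fin m → ℂ) : ℝ := Real.sqrt (∑ i, ‖v i‖ ^ 2)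

/-- A (linear) map `M : M(n₁,n₂) → ℂ^m` is stably `(s₁,s₂)`-injective if there is `C > 0` with
`‖M(X)‖₂ ≥ C ‖X‖_F` for all `X ∈ Δ(M¹_{s₁,s₂}(n₁,n₂))`. -/
def StablyInj (n₁ n₂ s₁ s₂ m : ℕ) (M : Matrix (Fin n₁) (Fin n₂) ℂ → (Fin m → ℂ)) : Prop :=
  ∃ C : ℝ, 0 < C ∧ ∀ X ∈ diffSet (M1 n₁ n₂ s₁ s₂), C * frob X ≤ l2 (M X)

open MeasureTheory

/-- For `Y ∈ M(m,n₁)`, `Z ∈ M(m,n₂)` (given by their rows), the linear map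
`M_{Y,Z}(X) = (tr(Z₁ᵗY₁X),…,tr(Z_mᵗY_mX))`, where `Z_iᵗY_i = vecMulVec Zᵢ Yᵢ` is the
rank-one `n₂×n₁` matrix with entries `(Zᵢ)_a (Yᵢ)_b`. -/
def MYZ {n₁ n₂ m : ℕ} (Y : Fin m → Fin n₁ → ℂ) (Z : Fin m → Fin n₂ → ℂ)
    (X : Matrix (Fin n₁) (Fin n₂) ℂ) : Fin m → ℂ :=
  fun i => Matrix.trace (Matrix.vecMulVec (Z i) (Y i) * X)


abbrev AM : Matroid ℂ := AlgebraicIndependent.matroid ℚ ℂ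

lemma mem_cl {s : Set ℂ} {a : ℂ} :
    a ∈ AM.closure s ↔ IsAlgebraic (Algebra.adjoin ℚ s) a := by
  rw [AlgebraicIndependent.matroid_closure_eq]; rfl

lemma cl_self {s : Set ℂ} {a : ℂ} (h : a ∈ s) : a ∈ AM.closure s :=
  AM.subset_closure s (by simp) h

lemma cl_add {s : Set ℂ} {a b : ℂ} (ha : a ∈ AM.closure s) (hb : b ∈ AM.closure s) :
    a + b ∈ AM.closure s := by
  rw [mem_cl] at *; exact ha.add hb

lemma cl_mul {s : Set ℂ} {a b : ℂ} (ha : a ∈ AM.closure s) (hb : b ∈ AM.closure s) :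
    a * b ∈ AM.closure s := by
  rw [mem_cl] at *; exact ha.mul hb

lemma cl_neg {s : Set ℂ} {a : ℂ} (ha : a ∈ AM.closure s) : -a ∈ AM.closure s := by
  rw [mem_cl] at *; exact ha.neg

lemma cl_inv {s : Set ℂ} {a : ℂ} (ha : a ∈ AM.closure s) : a⁻¹ ∈ AM.closure s := by
  rw [mem_cl] at *; exact ha.inv

lemma cl_sum {s : Set ℂ} {ι : Type*} (t : Finset ι) (f : ι → ℂ)
    (h : ∀ i ∈ t, f i ∈ AM.closure s) : ∑ i ∈ t, f i ∈ AM.closure s := by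
  classical
  induction t using Finset.induction_on with
  | empty => rw [mem_cl]; simpa using isAlgebraic_zero
  | insert a t ha ih =>
    rw [Finset.sum_insert ha]
    exact cl_add (h _ (by simp)) (ih fun i hi => h i (by simp [hi]))

lemma cl_countable {s : Set ℂ} (hs : s.Countable) : (AM.closure s).Countable := by
  have : Countable (Algebra.adjoin ℚ s) := by
    rw [← Cardinal.mk_le_aleph0_iff]
    refine (Algebra.cardinalMk_adjoin_le ℚ s).trans ?_
    simp [hs]
  have h := Algebraic.countable (Algebra.adjoin ℚ s) ℂ
  refine h.mono fun a ha => ?_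
  exact mem_cl.1 ha

lemma meas_indep {σ E : Type*} [Finite σ] [TopologicalSpace E] [MeasurableSpace E] [BorelSpace E]
    (x : E → σ → ℂ) (hx : Continuous x) (s : Set σ) :
    MeasurableSet {y | AlgebraicIndepOn ℚ (x y) s} := by
  have : {y | AlgebraicIndepOn ℚ (x y) s} = ⋂ p : MvPolynomial s ℚ, ⋂ _ : p ≠ 0,
      {y | MvPolynomial.aeval (fun i : s => x y i) p ≠ 0} := by
    ext y
    simp only [AlgebraicIndepOn, algebraicIndependent_iff, Set.mem_ofPred_eq, Set.mem_iInter]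
    exact forall_congr' fun p => by tauto
  rw [this]
  have : Countable (MvPolynomial s ℚ) := by
    rw [← Cardinal.mk_le_aleph0_iff]
    exact MvPolynomial.cardinalMk_le_max_lift.trans (by simp)
  refine MeasurableSet.iInter fun p => MeasurableSet.iInter fun _ => IsOpen.measurableSet ?_
  refine isOpen_ne_fun ?_ continuous_const
  have : Continuous fun z : s → ℂ => MvPolynomial.aeval z p := by
    simp_rw [MvPolynomial.aeval_def, ← MvPolynomial.eval_map]
    exact MvPolynomial.continuous_eval _
  exact this.comp (by fun_prop)

lemma ae_algInd {σ E : Type*} [Finite σ] [NormedAddCommGroup E] [NormedSpace ℝ E]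
    [MeasurableSpace E] [BorelSpace E] [FiniteDimensional ℝ E] (μ : Measure E)
    [μ.IsAddHaarMeasure] (x : E → σ → ℂ) (hx : Continuous x) (e : σ → (ℂ →ₗ[ℝ] E))
    (he : ∀ i t y, x (y + e i t) i = x y i + t)
    (he' : ∀ i j t y, j ≠ i → x (y + e i t) j = x y j) :
    ∀ᵐ y ∂μ, AlgebraicIndependent ℚ (x y) := by
  have key : ∀ s : Set σ, s.Finite → ∀ᵐ y ∂μ, AlgebraicIndepOn ℚ (x y) s := by
    intro s hs
    induction s, hs using Set.Finite.induction_on with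
    | empty =>
      refine Filter.Eventually.of_forall fun y => ?_
      simp only [AlgebraicIndepOn]
      rw [algebraicIndependent_empty_type_iff]
      exact (algebraMap ℚ ℂ).injective
    | @insert i s hi hs ih =>
      have : ∀ᵐ y ∂μ, y ∈ {y | AlgebraicIndepOn ℚ (x y) s}ᶜ ∪
          {y | AlgebraicIndepOn ℚ (x y) (insert i s)} := by
        refine ae_mem_of_ae_add_linearMap_mem (e i) volume μ
          ((meas_indep x hx s).compl.union (meas_indep x hx _)) fun y => ?_
        have hc : (AM.closure (x y '' s)).Countable := cl_countable (hs.image _).countable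
        have hc2 : {t : ℂ | x y i + t ∈ AM.closure (x y '' s)}.Countable :=
          hc.preimage (add_right_injective (x y i))
        filter_upwards [hc2.ae_notMem volume] with t ht
        have hE : x (y + e i t) '' s = x y '' s := by
          refine Set.image_congr fun j hj => he' i j t y ?_
          rintro rfl; exact hi hj
        by_cases h : AlgebraicIndepOn ℚ (x (y + e i t)) s
        · right
          simp only [Set.mem_ofPred_eq]
          rw [AlgebraicIndepOn.insert_iff hi]
          refine ⟨h, ?_⟩
          rw [hE, he]
          exact fun h' => ht (mem_cl.2 h')
        · left; exact h
      filter_upwards [this, ih] with y h1 h2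
      rcases h1 with h1 | h1
      · exact absurd h2 h1
      · exact h1
  filter_upwards [key Set.univ Set.finite_univ] with y hy
  exact AlgebraicIndepOn.univ.1 hy

lemma rel_cl {α β : Type*} [Fintype α] [Fintype β] (X : α → β → ℂ) (w : α ⊕ β → ℂ)
    (a₀ : α) (b₀ : β) (h0 : X a₀ b₀ ≠ 0)
    (h : ∑ a, w (.inl a) * ∑ b, X a b * w (.inr b) = 0) :
    ∃ c, w c ∈ AM.closure (Set.range (fun p : α × β => X p.1 p.2) ∪ w '' {c' | c' ≠ c}) := by
  classical
  by_cases hz : ∃ a, ∑ b, X a b * w (.inr b) ≠ 0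
  · obtain ⟨a, ha⟩ := hz
    refine ⟨.inl a, ?_⟩
    set s := (Set.range (fun p : α × β => X p.1 p.2) ∪ w '' {c' | c' ≠ .inl a})
    have hX : ∀ a b, X a b ∈ AM.closure s := fun a b => cl_self (Or.inl ⟨(a, b), rfl⟩)
    have hw : ∀ c, c ≠ .inl a → w c ∈ AM.closure s := fun c hc => cl_self (Or.inr ⟨c, hc, rfl⟩)
    have hin : ∀ a', ∑ b, X a' b * w (.inr b) ∈ AM.closure s := fun a' =>
      cl_sum _ _ fun b _ => cl_mul (hX _ _) (hw _ (by simp))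
    rw [← Finset.add_sum_erase _ _ (Finset.mem_univ a)] at h
    have : w (.inl a) = -(∑ x ∈ Finset.univ.erase a, w (.inl x) * ∑ b, X x b * w (.inr b)) *
        (∑ b, X a b * w (.inr b))⁻¹ := by
      field_simp
      linear_combination h
    rw [this]
    refine cl_mul (cl_neg (cl_sum _ _ fun x hx => cl_mul (hw _ ?_) (hin _))) (cl_inv (hin _))
    simpa using Finset.ne_of_mem_erase hx
  · push Not at hz
    refine ⟨.inr b₀, ?_⟩
    set s := (Set.range (fun p : α × β => X p.1 p.2) ∪ w '' {c' | c' ≠ .inr b₀})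
    have hX : ∀ a b, X a b ∈ AM.closure s := fun a b => cl_self (Or.inl ⟨(a, b), rfl⟩)
    have hw : ∀ c, c ≠ .inr b₀ → w c ∈ AM.closure s := fun c hc => cl_self (Or.inr ⟨c, hc, rfl⟩)
    have h := hz a₀
    rw [← Finset.add_sum_erase _ _ (Finset.mem_univ b₀)] at h
    have : w (.inr b₀) = -(∑ x ∈ Finset.univ.erase b₀, X a₀ x * w (.inr x)) *
        (X a₀ b₀)⁻¹ := by
      field_simp
      linear_combination h
    rw [this]
    refine cl_mul (cl_neg (cl_sum _ _ fun x hx => cl_mul (hX _ _) (hw _ ?_))) (cl_inv (hX _ _))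
    simpa using Finset.ne_of_mem_erase hx

lemma no_kernel {m : ℕ} {α β : Type} [Fintype α] [Fintype β] (X : α → β → ℂ)
    (w : Fin m × (α ⊕ β) → ℂ) (hind : AlgebraicIndependent ℚ w)
    (a₀ : α) (b₀ : β) (h0 : X a₀ b₀ ≠ 0)
    (hrk : AM.eRk (Set.range (fun p : α × β => X p.1 p.2)) + 1 ≤ m)
    (h : ∀ i, ∑ a, w (i, .inl a) * ∑ b, X a b * w (i, .inr b) = 0) : False := by
  classical
  choose c hc using fun i => rel_cl X (fun q => w (i, q)) a₀ b₀ h0 (h i)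
  set T := Set.range (fun p : α × β => X p.1 p.2)
  set A : Set (Fin m × (α ⊕ β)) := {q | q.2 ≠ c q.1}
  have hsub : Set.range w ⊆ AM.closure (T ∪ w '' A) := by
    rintro _ ⟨⟨i, q⟩, rfl⟩
    by_cases hq : q = c i
    · subst hq
      refine AM.closure_subset_closure ?_ (hc i)
      refine Set.union_subset_union_right _ ?_
      rintro _ ⟨q, hq, rfl⟩
      exact ⟨(i, q), hq, rfl⟩
    · exact cl_self (Or.inr ⟨(i, q), hq, rfl⟩)
  have h1 : AM.eRk (Set.range w) = (Set.range w).encard := by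
    apply Matroid.Indep.eRk_eq_encard
    rw [AlgebraicIndependent.matroid_indep_iff]
    exact hind.to_subtype_range
  have h2 : (Set.range w).encard = (Set.univ : Set (Fin m × (α ⊕ β))).encard := by
    rw [← Set.image_univ, hind.injective.encard_image]
  have h3 : AM.eRk (Set.range w) ≤ AM.eRk T + A.encard := by
    refine (AM.eRk_mono hsub).trans ?_
    rw [Matroid.eRk_closure_eq]
    refine (AM.eRk_union_le_eRk_add_encard _ _).trans ?_
    gcongr
    exact Set.encard_image_le _ _
  have h4 : A.encard + m = (Set.univ : Set (Fin m × (α ⊕ β))).encard := by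
    rw [← Set.encard_add_encard_compl A]
    congr 1
    have : Aᶜ = Set.range (fun i => (i, c i)) := by
      ext ⟨i, q⟩
      simp [A, eq_comm]
    rw [this, ← Set.image_univ, Function.Injective.encard_image]
    · simp
    · intro i j hij; exact (Prod.ext_iff.1 hij).1
  rw [h1, h2, ← h4] at h3
  have hA : A.encard ≠ ⊤ := (Set.toFinite A).encard_lt_top.ne
  generalize AM.eRk T = r at *
  generalize A.encard = k at *
  rw [add_comm] at h3
  have h5 : (m : ℕ∞) ≤ r := (ENat.add_le_add_iff_right hA).1 h3
  have h6 := (add_le_add_left h5 1).trans hrk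
  exact absurd h6 (by exact_mod_cast Nat.not_succ_le_self m)

lemma exists_scale {α β : Type} [Fintype α] [Fintype β] (X : α → β → ℂ) (D : ℕ)
    (a₀ : α) (b₀ : β) (h0 : X a₀ b₀ ≠ 0)
    (h : ∀ t : ℂ, AM.eRk (Set.range (fun p : α × β => t * X p.1 p.2)) ≤ D) :
    ∃ s : ℂ, s ≠ 0 ∧ AM.eRk (Set.range (fun p : α × β => s * X p.1 p.2)) + 1 ≤ D := by
  refine ⟨(X a₀ b₀)⁻¹, inv_ne_zero h0, ?_⟩
  set T := Set.range (fun p : α × β => (X a₀ b₀)⁻¹ * X p.1 p.2)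
  have hT : T.Countable := Set.countable_range _
  obtain ⟨t, ht⟩ : ∃ t, t ∉ AM.closure T := by
    by_contra! hh
    have : (Set.univ : Set ℂ).Countable := (cl_countable hT).mono fun t _ => hh t
    exact not_countable_complex this
  have ht0 : t ≠ 0 := by
    rintro rfl
    exact ht (mem_cl.2 isAlgebraic_zero)
  rw [← Matroid.eRk_insert_eq_add_one (M := AM) (e := t) (X := T) ⟨by simp, ht⟩]
  refine le_trans ?_ (h (t * (X a₀ b₀)⁻¹))
  rw [← AM.eRk_closure_eq (Set.range (fun p : α × β => t * (X a₀ b₀)⁻¹ * X p.1 p.2))]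
  apply AM.eRk_mono
  set R := Set.range (fun p : α × β => t * (X a₀ b₀)⁻¹ * X p.1 p.2)
  have htR : t ∈ AM.closure R := cl_self ⟨(a₀, b₀), by simp [h0]⟩
  rintro x (rfl | ⟨p, rfl⟩)
  · exact htR
  · have : (X a₀ b₀)⁻¹ * X p.1 p.2 = t⁻¹ * (t * (X a₀ b₀)⁻¹ * X p.1 p.2) := by
      field_simp
    simp only []
    rw [this]
    exact cl_mul (cl_inv htR) (cl_self ⟨p, rfl⟩)

lemma rk_closure {σ ι : Type} [Fintype σ] (F : ι → MvPolynomial σ ℚ) (W : ι → ℂ)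
    (h : W ∈ closure (Set.range fun (p : σ → ℂ) (c : ι) => MvPolynomial.aeval p (F c))) :
    AM.eRk (Set.range W) ≤ Fintype.card σ := by
  rw [Matroid.eRk_le_iff]
  intro I hI hind
  rw [AlgebraicIndependent.matroid_indep_iff] at hind
  choose f hf using fun i : I => hI i.2
  have hF : AlgebraicIndependent ℚ (fun i : I => F (f i)) := by
    rw [algebraicIndependent_iff]
    intro g hg
    apply (algebraicIndependent_iff.1 hind) g
    have hcl : IsClosed {V : ι → ℂ | MvPolynomial.aeval (fun i : I => V (f i)) g = 0} := by
      refine isClosed_eq ?_ continuous_const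
      have : Continuous fun z : I → ℂ => MvPolynomial.aeval z g := by
        simp_rw [MvPolynomial.aeval_def, ← MvPolynomial.eval_map]
        exact MvPolynomial.continuous_eval _
      exact this.comp (by fun_prop)
    have := closure_minimal (t := {V : ι → ℂ | MvPolynomial.aeval (fun i : I => V (f i)) g = 0})
      ?_ hcl h
    · have h2 : (fun i : I => W (f i)) = fun i : I => id (i : ℂ) := funext hf
      simpa [h2] using this
    · rintro _ ⟨p, rfl⟩
      have := congrArg (MvPolynomial.aeval p) hg
      rw [← AlgHom.comp_apply, MvPolynomial.comp_aeval] at this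
      simpa using this
  have := hF.lift_cardinalMk_le_trdeg
  rw [MvPolynomial.trdeg_of_isDomain] at this
  simp at this
  have hfin : I.Finite := by
    rw [← Cardinal.lt_aleph0_iff_set_finite]; exact this.trans_lt (Cardinal.natCast_lt_aleph0)
  rw [← hfin.cast_ncard_eq]
  rw [← Set.cast_ncard hfin] at this
  exact_mod_cast this

def Good {n₁ n₂ : ℕ} (D : ℕ) (S : Set (Matrix (Fin n₁) (Fin n₂) ℂ)) : Prop :=
  ∀ W ∈ closure S, AM.eRk (Set.range (fun p : Fin n₁ × Fin n₂ => W p.1 p.2)) ≤ D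

lemma good_iUnion {n₁ n₂ D : ℕ} {ι : Type*} [Finite ι]
    (P : ι → Set (Matrix (Fin n₁) (Fin n₂) ℂ)) (h : ∀ i, Good D (P i)) : Good D (⋃ i, P i) := by
  intro W hW
  rw [closure_iUnion_of_finite] at hW
  obtain ⟨i, hi⟩ := Set.mem_iUnion.1 hW
  exact h i W hi

lemma good_mono {n₁ n₂ D : ℕ} {P Q : Set (Matrix (Fin n₁) (Fin n₂) ℂ)} (h : P ⊆ Q)
    (hQ : Good D Q) : Good D P := fun W hW => hQ W (closure_mono h hW)

def QS {n₁ n₂ : ℕ} (S₁ S₃ : Finset (Fin n₁)) (S₂ S₄ : Finset (Fin n₂))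
    (β₁ β₃ : Fin n₁ → ℚ) (β₂ β₄ : Fin n₂ → ℚ) : Set (Matrix (Fin n₁) (Fin n₂) ℂ) :=
  {X | ∃ (u : Fin n₁ → ℂ) (v : Fin n₂ → ℂ) (u' : Fin n₁ → ℂ) (v' : Fin n₂ → ℂ), (∀ a ∉ S₁, u a = β₁ a) ∧ (∀ a ∉ S₂, v a = β₂ a) ∧
    (∀ a ∉ S₃, u' a = β₃ a) ∧ (∀ a ∉ S₄, v' a = β₄ a) ∧
    X = Matrix.vecMulVec u v - Matrix.vecMulVec u' v'}

def pvec {n : ℕ} {σ : Type} (S : Finset (Fin n)) (β : Fin n → ℚ) (emb : S → σ) :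
    Fin n → MvPolynomial σ ℚ :=
  fun a => if h : a ∈ S then MvPolynomial.X (emb ⟨a, h⟩) else MvPolynomial.C (β a)

lemma pvec_eval {n : ℕ} {σ : Type} (S : Finset (Fin n)) (β : Fin n → ℚ) (emb : S → σ)
    (p : σ → ℂ) (u : Fin n → ℂ) (h : ∀ a ∉ S, u a = β a) (h2 : ∀ a : S, p (emb a) = u a)
    (a : Fin n) : MvPolynomial.aeval p (pvec S β emb a) = u a := by
  unfold pvec
  split_ifs with ha
  · simp [h2]
  · simp [h a ha]

lemma QS_good {n₁ n₂ : ℕ} (S₁ S₃ : Finset (Fin n₁)) (S₂ S₄ : Finset (Fin n₂))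
    (β₁ β₃ : Fin n₁ → ℚ) (β₂ β₄ : Fin n₂ → ℚ) (D : ℕ)
    (hD : S₁.card + S₂.card + S₃.card + S₄.card ≤ D) :
    Good D (QS S₁ S₃ S₂ S₄ β₁ β₃ β₂ β₄) := by
  intro W hW
  let F : Fin n₁ × Fin n₂ → MvPolynomial (((S₁ ⊕ S₂) ⊕ S₃) ⊕ S₄) ℚ := fun q =>
    pvec S₁ β₁ (fun a => .inl (.inl (.inl a))) q.1 * pvec S₂ β₂ (fun a => .inl (.inl (.inr a))) q.2
    - pvec S₃ β₃ (fun a => .inl (.inr a)) q.1 * pvec S₄ β₄ (fun a => .inr a) q.2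
  have := rk_closure F (fun q => W q.1 q.2) ?_
  · refine this.trans ?_
    simp only [Fintype.card_sum, Fintype.card_coe]
    exact_mod_cast hD
  · have hc : Continuous fun (W : Matrix (Fin n₁) (Fin n₂) ℂ) (q : Fin n₁ × Fin n₂) => W q.1 q.2 :=
      continuous_pi fun q => continuous_id.matrix_elem q.1 q.2
    refine map_mem_closure hc hW ?_
    rintro X ⟨u, v, u', v', h1, h2, h3, h4, rfl⟩
    refine ⟨Sum.elim (Sum.elim (Sum.elim (fun a => u a) fun a => v a) fun a => u' a)
      fun a => v' a, ?_⟩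
    funext q
    simp only [F, map_sub, map_mul]
    rw [pvec_eval _ _ _ _ u h1, pvec_eval _ _ _ _ v h2, pvec_eval _ _ _ _ u' h3,
      pvec_eval _ _ _ _ v' h4] <;> simp [Matrix.vecMulVec_apply]

lemma sparse_norm {n₁ n₂ s₁ s₂ : ℕ} (hn : 2 ≤ n₁) (hs : 1 ≤ s₁) (u : Fin n₁ → ℂ) (v : Fin n₂ → ℂ)
    (hu : Sparse s₁ u) (hv : Sparse s₂ v) :
    ∃ (S : Finset (Fin n₁)) (k : Fin n₁) (T : Finset (Fin n₂)) (u' : Fin n₁ → ℂ) (v' : Fin n₂ → ℂ),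
      S.card + 1 ≤ s₁ ∧ T.card ≤ s₂ ∧ (∀ a ∉ S, u' a = ((Pi.single k 1 : Fin n₁ → ℚ) a : ℚ)) ∧
      (∀ a ∉ T, v' a = ((0 : Fin n₂ → ℚ) a : ℚ)) ∧
      Matrix.vecMulVec u v = Matrix.vecMulVec u' v' := by
  classical
  by_cases h0 : ∃ k, u k ≠ 0
  · obtain ⟨k, hk⟩ := h0
    refine ⟨(Finset.univ.filter fun i => u i ≠ 0).erase k, k, Finset.univ.filter fun i => v i ≠ 0,
      fun a => u a / u k, fun b => u k * v b, ?_, ?_, ?_, ?_, ?_⟩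
    · rw [Finset.card_erase_add_one (by simp [hk])]
      unfold Sparse at hu
      rw [Set.ncard_eq_toFinset_card'] at hu
      simpa using hu
    · unfold Sparse at hv
      rw [Set.ncard_eq_toFinset_card'] at hv
      simpa using hv
    · intro a ha
      by_cases hak : a = k
      · subst hak; simp [hk]
      · have : u a = 0 := by simpa [hak] using ha
        simp [hak, this]
    · intro a ha
      have : v a = 0 := by simpa using ha
      simp [this]
    · ext a b
      simp only [Matrix.vecMulVec_apply]
      field_simp
  · push Not at h0
    have : u = 0 := funext h0
    subst this
    refine ⟨∅, ⟨0, by omega⟩, ∅, fun a => ((Pi.single ⟨0, by omega⟩ 1 : Fin n₁ → ℚ) a : ℚ), 0,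
      by simpa using hs, by simp, by simp, by simp, by ext; simp [Matrix.vecMulVec_apply]⟩

lemma good_sparse (n₁ n₂ s₁ s₂ : ℕ) (hn₁ : 2 ≤ n₁) (hs₁ : 1 ≤ s₁) :
    Good (2 * (s₁ + s₂) - 2) (diffSet (M1 n₁ n₂ s₁ s₂)) := by
  let ι := {j : (Finset (Fin n₁) × Finset (Fin n₂)) × (Finset (Fin n₁) × Finset (Fin n₂)) //
    (j.1.1.card + 1 ≤ s₁ ∧ j.1.2.card ≤ s₂) ∧ (j.2.1.card + 1 ≤ s₁ ∧ j.2.2.card ≤ s₂)} ×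
    (Fin n₁ × Fin n₁)
  refine good_mono (Q := ⋃ j : ι, QS j.1.1.1.1 j.1.1.2.1 j.1.1.1.2 j.1.1.2.2
    (Pi.single j.2.1 1) (Pi.single j.2.2 1) 0 0) ?_ (good_iUnion _ ?_)
  · rintro X ⟨_, ⟨u, v, hu, hv, rfl⟩, _, ⟨u', v', hu', hv', rfl⟩, rfl⟩
    obtain ⟨S, k, T, x, y, h1, h2, h3, h4, h5⟩ := sparse_norm hn₁ hs₁ u v hu hv
    obtain ⟨S', k', T', x', y', h1', h2', h3', h4', h5'⟩ := sparse_norm hn₁ hs₁ u' v' hu' hv'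
    rw [Set.mem_iUnion]
    refine ⟨⟨⟨((S, T), (S', T')), ⟨h1, h2⟩, h1', h2'⟩, k, k'⟩, x, y, x', y', h3, h4, h3', h4', ?_⟩
    rw [h5, h5']
  · rintro ⟨⟨j, hj⟩, k⟩
    apply QS_good
    simp only
    omega

lemma echelon_aux {n : ℕ} (hn : 2 ≤ n) (v v' : Fin n → ℂ)
    (h : ∀ k l, v k * v' l - v l * v' k = 0) (k : Fin n) (hk : v k ≠ 0) :
    ∃ (k l : Fin n) (b b' : Fin n → ℂ) (c₁ c₂ c₃ c₄ : ℂ), k ≠ l ∧ b k = 1 ∧ b l = 0 ∧ b' k = 0 ∧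
      b' l = 1 ∧ (∀ a, v a = c₁ * b a + c₂ * b' a) ∧ (∀ a, v' a = c₃ * b a + c₄ * b' a) := by
  classical
  have : Nontrivial (Fin n) := Fin.nontrivial_iff_two_le.2 hn
  obtain ⟨l, hl⟩ := exists_ne k
  have hv : ∀ a, v a = v k * (v a / v k - v l / v k * (Pi.single l 1 : Fin n → ℂ) a) +
      v l * (Pi.single l 1 : Fin n → ℂ) a := fun a => by field_simp; ring
  have hv' : ∀ a, v' a = v' k / v k * v a := fun a => by
    field_simp
    linear_combination h k a
  refine ⟨k, l, fun a => v a / v k - v l / v k * (Pi.single l 1 : Fin n → ℂ) a, Pi.single l 1,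
    v k, v l, v' k, v' k / v k * v l, hl.symm, ?_, ?_, ?_, ?_, hv, ?_⟩
  · simp [hl.symm, hk]
  · simp
  · simp [hl.symm]
  · simp
  · intro a
    rw [hv' a]
    nth_rw 1 [hv a]
    field_simp

lemma echelon {n : ℕ} (hn : 2 ≤ n) (v v' : Fin n → ℂ) :
    ∃ (k l : Fin n) (b b' : Fin n → ℂ) (c₁ c₂ c₃ c₄ : ℂ), k ≠ l ∧ b k = 1 ∧ b l = 0 ∧ b' k = 0 ∧
      b' l = 1 ∧ (∀ a, v a = c₁ * b a + c₂ * b' a) ∧ (∀ a, v' a = c₃ * b a + c₄ * b' a) := by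
  classical
  by_cases h : ∀ k l, v k * v' l - v l * v' k = 0
  · by_cases hv : ∃ k, v k ≠ 0
    · obtain ⟨k, hk⟩ := hv
      exact echelon_aux hn v v' h k hk
    by_cases hv' : ∃ k, v' k ≠ 0
    · obtain ⟨k, hk⟩ := hv'
      obtain ⟨k, l, b, b', c₁, c₂, c₃, c₄, h1, h2, h3, h4, h5, h6, h7⟩ :=
        echelon_aux hn v' v (fun k l => by linear_combination -h k l) k hk
      exact ⟨k, l, b, b', c₃, c₄, c₁, c₂, h1, h2, h3, h4, h5, h7, h6⟩
    push Not at hv hv'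
    have : Nontrivial (Fin n) := Fin.nontrivial_iff_two_le.2 hn
    obtain ⟨k, l, hl⟩ := exists_pair_ne (Fin n)
    exact ⟨k, l, Pi.single k 1, Pi.single l 1, 0, 0, 0, 0, hl, by simp, by simp [hl.symm],
      by simp [hl], by simp, by simp [hv], by simp [hv']⟩
  · push Not at h
    obtain ⟨k, l, hd⟩ := h
    set d := v k * v' l - v l * v' k with hdd
    refine ⟨k, l, fun a => (v' l * v a - v l * v' a) / d, fun a => (v k * v' a - v' k * v a) / d,
      v k, v l, v' k, v' l, ?_, ?_, ?_, ?_, ?_, ?_, ?_⟩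
    · rintro rfl; apply hd; rw [hdd]; ring
    · rw [div_eq_one_iff_eq hd, hdd]; ring
    · rw [div_eq_zero_iff]; left; ring
    · rw [div_eq_zero_iff]; left; ring
    · rw [div_eq_one_iff_eq hd, hdd]; ring
    · intro a; field_simp; rw [hdd]; ring
    · intro a; field_simp; rw [hdd]; ring

lemma good_dense (n₁ n₂ s₁ s₂ : ℕ) (hn₂ : 2 ≤ n₂) :
    Good (2 * (n₁ + n₂) - 4) (diffSet (M1 n₁ n₂ s₁ s₂)) := by
  classical
  let ι := {j : Fin n₂ × Fin n₂ // j.1 ≠ j.2}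
  refine good_mono (Q := ⋃ j : ι, QS Finset.univ Finset.univ
    ((Finset.univ.erase j.1.1).erase j.1.2) ((Finset.univ.erase j.1.1).erase j.1.2) 0 0
    (Pi.single j.1.1 1) (Pi.single j.1.2 1)) ?_ (good_iUnion _ ?_)
  · rintro X ⟨_, ⟨u, v, hu, hv, rfl⟩, _, ⟨u', v', hu', hv', rfl⟩, rfl⟩
    obtain ⟨k, l, b, b', c₁, c₂, c₃, c₄, h1, h2, h3, h4, h5, h6, h7⟩ := echelon hn₂ v v'
    rw [Set.mem_iUnion]
    refine ⟨⟨(k, l), h1⟩, fun a => c₁ * u a - c₃ * u' a, b, fun a => -(c₂ * u a - c₄ * u' a), b',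
      by simp, ?_, by simp, ?_, ?_⟩
    · intro a ha
      by_cases hl : a = l
      · subst hl; simp [h3, h1.symm]
      · by_cases hk : a = k
        · subst hk; simp [h2]
        · simp [hk, hl] at ha
    · intro a ha
      by_cases hl : a = l
      · subst hl; simp [h5]
      · by_cases hk : a = k
        · subst hk; simp [h4, h1]
        · simp [hk, hl] at ha
    · ext a c
      simp only [Matrix.sub_apply, Matrix.vecMulVec_apply, h6, h7]
      ring
  · rintro ⟨⟨k, l⟩, h⟩
    apply QS_good
    simp only [Finset.card_univ, Fintype.card_fin]
    rw [Finset.card_erase_of_mem (by simpa using h.symm), Finset.card_erase_of_mem (by simp)]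
    simp only [Finset.card_univ, Fintype.card_fin]
    omega

lemma MYZ_eq {n₁ n₂ m : ℕ} (Y : Fin m → Fin n₁ → ℂ) (Z : Fin m → Fin n₂ → ℂ)
    (X : Matrix (Fin n₁) (Fin n₂) ℂ) (i : Fin m) :
    MYZ Y Z X i = ∑ a, Y i a * ∑ b, X a b * Z i b := by
  simp only [MYZ, Matrix.trace, Matrix.diag, Matrix.mul_apply, Matrix.vecMulVec_apply]
  rw [Finset.sum_comm]
  refine Finset.sum_congr rfl fun a _ => ?_
  rw [Finset.mul_sum]
  exact Finset.sum_congr rfl fun b _ => by ring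

lemma MYZ_smul {n₁ n₂ m : ℕ} (Y : Fin m → Fin n₁ → ℂ) (Z : Fin m → Fin n₂ → ℂ)
    (X : Matrix (Fin n₁) (Fin n₂) ℂ) (t : ℂ) : MYZ Y Z (t • X) = t • MYZ Y Z X := by
  funext i
  simp [MYZ]

lemma frob_smul {a b : ℕ} (X : Matrix (Fin a) (Fin b) ℂ) (t : ℂ) :
    frob (t • X) = ‖t‖ * frob X := by
  unfold frob
  simp only [Matrix.smul_apply, smul_eq_mul, norm_mul, mul_pow, ← Finset.mul_sum]
  rw [Real.sqrt_mul (by positivity), Real.sqrt_sq (norm_nonneg _)]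

lemma l2_smul {m : ℕ} (v : Fin m → ℂ) (t : ℂ) : l2 (t • v) = ‖t‖ * l2 v := by
  unfold l2
  simp only [Pi.smul_apply, smul_eq_mul, norm_mul, mul_pow, ← Finset.mul_sum]
  rw [Real.sqrt_mul (by positivity), Real.sqrt_sq (norm_nonneg _)]

lemma sparse_smul {n s : ℕ} {u : Fin n → ℂ} (h : Sparse s u) (t : ℂ) : Sparse s (t • u) := by
  unfold Sparse at *
  refine (Set.ncard_le_ncard ?_ (Set.toFinite _)).trans h
  intro i hi
  exact fun h0 => hi (by simp [h0])

lemma diff_smul {n₁ n₂ s₁ s₂ : ℕ} {X : Matrix (Fin n₁) (Fin n₂) ℂ}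
    (h : X ∈ diffSet (M1 n₁ n₂ s₁ s₂)) (t : ℂ) : t • X ∈ diffSet (M1 n₁ n₂ s₁ s₂) := by
  obtain ⟨_, ⟨u, v, hu, hv, rfl⟩, _, ⟨u', v', hu', hv', rfl⟩, rfl⟩ := h
  refine ⟨_, ⟨t • u, v, sparse_smul hu t, hv, rfl⟩, _, ⟨t • u', v', sparse_smul hu' t, hv', rfl⟩, ?_⟩
  rw [Matrix.smul_vecMulVec, Matrix.smul_vecMulVec, smul_sub]

lemma frob_cont {a b : ℕ} : Continuous (frob : Matrix (Fin a) (Fin b) ℂ → ℝ) := by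
  unfold frob
  refine Real.continuous_sqrt.comp ?_
  refine continuous_finsetSum _ fun i _ => continuous_finsetSum _ fun j _ => ?_
  exact (continuous_id.matrix_elem i j).norm.pow 2

lemma frob_entry {a b : ℕ} (X : Matrix (Fin a) (Fin b) ℂ) (i : Fin a) (j : Fin b) :
    ‖X i j‖ ≤ frob X := by
  unfold frob
  apply Real.le_sqrt_of_sq_le
  refine le_trans ?_ (Finset.single_le_sum (f := fun i => ∑ j, ‖X i j‖ ^ 2)
    (fun i _ => by positivity) (Finset.mem_univ i))
  exact Finset.single_le_sum (f := fun j => ‖X i j‖ ^ 2) (fun i _ => by positivity)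
    (Finset.mem_univ j)

lemma stab {n₁ n₂ s₁ s₂ m : ℕ} (Y : Fin m → Fin n₁ → ℂ) (Z : Fin m → Fin n₂ → ℂ)
    (h : ∀ X ∈ closure (diffSet (M1 n₁ n₂ s₁ s₂)), ∀ a b, X a b ≠ 0 → MYZ Y Z X ≠ 0) :
    StablyInj n₁ n₂ s₁ s₂ m (MYZ Y Z) := by
  set K : Set (Matrix (Fin n₁) (Fin n₂) ℂ) :=
    closure (diffSet (M1 n₁ n₂ s₁ s₂)) ∩ {X | frob X = 1} with hKdef
  have hK : IsCompact K := by
    have hB : IsCompact (Set.pi Set.univ fun _ : Fin n₁ => Set.pi Set.univ fun _ : Fin n₂ =>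
        Metric.closedBall (0 : ℂ) 1) :=
      isCompact_univ_pi fun _ => isCompact_univ_pi fun _ => isCompact_closedBall _ _
    refine hB.of_isClosed_subset (isClosed_closure.inter (isClosed_eq frob_cont continuous_const)) ?_
    rintro X ⟨_, hX⟩ i _ j _
    rw [mem_closedBall_zero_iff, ← hX]
    exact frob_entry X i j
  have hl : Continuous fun X => l2 (MYZ Y Z X) := by
    unfold l2
    refine Real.continuous_sqrt.comp (continuous_finsetSum _ fun i _ => ?_)
    simp only [MYZ_eq]
    refine Continuous.pow (Continuous.norm ?_) 2
    exact continuous_finsetSum _ fun a _ => continuous_const.mul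
      (continuous_finsetSum _ fun b _ => (continuous_id.matrix_elem a b).mul continuous_const)
  obtain ⟨C, hC, hCK⟩ : ∃ C : ℝ, 0 < C ∧ ∀ X ∈ K, C ≤ l2 (MYZ Y Z X) := by
    rcases K.eq_empty_or_nonempty with h0 | hne
    · exact ⟨1, one_pos, by simp [h0]⟩
    obtain ⟨X, hX, hmin⟩ := hK.exists_isMinOn hne hl.continuousOn
    refine ⟨_, ?_, fun Y hY => hmin hY⟩
    obtain ⟨a, b, hab⟩ : ∃ a b, X a b ≠ 0 := by
      by_contra! h0
      have h1 : frob X = 1 := hX.2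
      simp [frob, h0] at h1
    have hne := h X hX.1 a b hab
    obtain ⟨i, hi⟩ := Function.ne_iff.1 hne
    refine Real.sqrt_pos.2 (Finset.sum_pos' (fun i _ => by positivity) ⟨i, Finset.mem_univ _, ?_⟩)
    have : 0 < ‖MYZ Y Z X i‖ := norm_pos_iff.2 hi
    positivity
  refine ⟨C, hC, fun X hX => ?_⟩
  have h0 : 0 ≤ frob X := Real.sqrt_nonneg _
  rcases h0.eq_or_lt with h0 | h0
  · rw [← h0, mul_zero]; exact Real.sqrt_nonneg _
  · have := hCK (((frob X)⁻¹ : ℝ) • (1 : ℂ) • X) ⟨subset_closure ?_, ?_⟩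
    · rw [one_smul, ← Complex.coe_smul, MYZ_smul, l2_smul] at this
      rw [Complex.norm_real, Real.norm_of_nonneg (by positivity)] at this
      field_simp at this
      exact this
    · rw [one_smul, ← Complex.coe_smul]; exact diff_smul hX _
    · rw [one_smul, ← Complex.coe_smul]
      show frob _ = 1
      rw [frob_smul, Complex.norm_real, Real.norm_of_nonneg (by positivity)]
      field_simp

lemma stab_of_good {n₁ n₂ s₁ s₂ m D : ℕ} (hD : D ≤ m)
    (hG : Good D (diffSet (M1 n₁ n₂ s₁ s₂)))
    (Y : Fin m → Fin n₁ → ℂ) (Z : Fin m → Fin n₂ → ℂ)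
    (hind : AlgebraicIndependent ℚ (fun q : Fin m × (Fin n₁ ⊕ Fin n₂) =>
      Sum.elim (Y q.1) (Z q.1) q.2)) :
    StablyInj n₁ n₂ s₁ s₂ m (MYZ Y Z) := by
  refine stab Y Z fun X hX a b hab h0 => ?_
  obtain ⟨s, hs, hrk⟩ := exists_scale X D a b hab fun t => by
    have : t • X ∈ closure (diffSet (M1 n₁ n₂ s₁ s₂)) :=
      map_mem_closure (continuous_const_smul t) hX fun X hX => diff_smul hX t
    exact hG _ this
  refine no_kernel (fun a b => s * X a b) _ hind a b (mul_ne_zero hs hab)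
    (hrk.trans (by exact_mod_cast hD)) fun i => ?_
  have := congrFun (MYZ_smul Y Z X s) i
  rw [h0, MYZ_eq] at this
  simpa using this

lemma haar_vol (m n : ℕ) : (volume : Measure (Fin m → Fin n → ℂ)).IsAddHaarMeasure := by
  have h1 : (volume : Measure (Fin n → ℂ)).IsAddHaarMeasure := inferInstance
  exact Measure.pi.isAddHaarMeasure (fun _ : Fin m => (volume : Measure (Fin n → ℂ)))

lemma ae_ind (n₁ n₂ m : ℕ) :
    ∀ᵐ YZ ∂(volume : Measure ((Fin m → Fin n₁ → ℂ) × (Fin m → Fin n₂ → ℂ))),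
      AlgebraicIndependent ℚ (fun q : Fin m × (Fin n₁ ⊕ Fin n₂) =>
        Sum.elim (YZ.1 q.1) (YZ.2 q.1) q.2) := by
  classical
  have := haar_vol m n₁
  have := haar_vol m n₂
  have : (volume : Measure ((Fin m → Fin n₁ → ℂ) × (Fin m → Fin n₂ → ℂ))).IsAddHaarMeasure :=
    Measure.prod.instIsAddHaarMeasure _ _
  let e : Fin m × (Fin n₁ ⊕ Fin n₂) → (ℂ →ₗ[ℝ] ((Fin m → Fin n₁ → ℂ) × (Fin m → Fin n₂ → ℂ))) :=
    fun q => Sum.elim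
      (fun a => LinearMap.inl ℝ (Fin m → Fin n₁ → ℂ) (Fin m → Fin n₂ → ℂ) ∘ₗ
        LinearMap.single ℝ (fun _ : Fin m => Fin n₁ → ℂ) q.1 ∘ₗ
        LinearMap.single ℝ (fun _ : Fin n₁ => ℂ) a)
      (fun a => LinearMap.inr ℝ (Fin m → Fin n₁ → ℂ) (Fin m → Fin n₂ → ℂ) ∘ₗ
        LinearMap.single ℝ (fun _ : Fin m => Fin n₂ → ℂ) q.1 ∘ₗ
        LinearMap.single ℝ (fun _ : Fin n₂ => ℂ) a) q.2
  have b1 : BorelSpace (Fin m → Fin n₁ → ℂ) := inferInstance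
  have b2 : BorelSpace (Fin m → Fin n₂ → ℂ) := inferInstance
  have b3 : BorelSpace ((Fin m → Fin n₁ → ℂ) × (Fin m → Fin n₂ → ℂ)) := inferInstance
  have f1 : FiniteDimensional ℝ ((Fin m → Fin n₁ → ℂ) × (Fin m → Fin n₂ → ℂ)) := inferInstance
  refine ae_algInd (σ := Fin m × (Fin n₁ ⊕ Fin n₂))
    (E := (Fin m → Fin n₁ → ℂ) × (Fin m → Fin n₂ → ℂ)) volume
    (fun YZ q => Sum.elim (YZ.1 q.1) (YZ.2 q.1) q.2) ?_ e ?_ ?_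
  · refine continuous_pi ?_
    rintro ⟨i, a | a⟩ <;> simp only [Sum.elim_inl, Sum.elim_inr] <;> fun_prop
  · rintro ⟨i, a | a⟩ t y <;> simp [e]
  · rintro ⟨i, a | a⟩ ⟨j, b | b⟩ t y h <;> simp [e]
    all_goals
      by_cases hij : j = i
      · subst hij
        have : b ≠ a := fun h' => h (by rw [h'])
        simp [this]
      · simp [hij]

theorem stmt2 (n₁ n₂ s₁ s₂ m : ℕ) (hn₁ : 2 ≤ n₁) (hn₂ : 2 ≤ n₂)
    (hs₁ : 1 ≤ s₁) (hs₁n : s₁ ≤ n₁) (hs₂ : 1 ≤ s₂) (hs₂n : s₂ ≤ n₂)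
    (hm : if s₁ = n₁ ∧ s₂ = n₂ then 2 * (n₁ + n₂) - 4 ≤ m else 2 * (s₁ + s₂) - 2 ≤ m) :
    ∀ᵐ YZ ∂(volume : Measure ((Fin m → Fin n₁ → ℂ) × (Fin m → Fin n₂ → ℂ))),
      StablyInj n₁ n₂ s₁ s₂ m (MYZ YZ.1 YZ.2) := by

  filter_upwards [ae_ind n₁ n₂ m] with YZ hYZ
  split_ifs at hm with h
  · exact stab_of_good hm (good_dense n₁ n₂ s₁ s₂ hn₂) _ _ hYZ
  · exact stab_of_good hm (good_sparse n₁ n₂ s₁ s₂ hn₁ hs₁) _ _ hYZ
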